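/- arXiv:2501.10005 — 2 statements merged into one kernel-verified Lean document; each statement's English description precedes it below -/
import Mathlib

section
/- Let R be a commutative ring with identity. Every Artinian comorphic R-module M is a principal ideal multiplication R-module, i.e., every submodule of M equals rM for some r ∈ R. -/
open Pointwise

/-- A proper submodule `L` of a module is completely irreducible if whenever `L` is the
intersection of a family of submodules, it equals one of them. -/
def CompletelyIrreducible {R M : Type*} [CommRing R] [AddCommGroup M] [Module R M]
    (L : Submodule R M) : Prop :=
  L ≠ ⊤ ∧ ∀ S : Set (Submodule R M), L = sInf S → L ∈ S

/-- `M` is a comorphic `R`-module if every completely irreducible submodule `L`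
satisfies `L = aM` and `(L :_R M) = Ra + Ann_R(M)` for some `a ∈ R`. -/
def Comorphic (R M : Type*) [CommRing R] [AddCommGroup M] [Module R M] : Prop :=
  ∀ L : Submodule R M, CompletelyIrreducible L →
    ∃ a : R, L = a • (⊤ : Submodule R M) ∧
      L.colon ⊤ = Ideal.span {a} + (⊤ : Submodule R M).annihilator

section Helpers

variable {R M M' : Type*} [CommRing R] [AddCommGroup M] [Module R M] [AddCommGroup M'] [Module R M']

theorem completelyIrreducible_iff {L : Submodule R M} :
    CompletelyIrreducible L ↔ ∃ x ∉ L, ∀ K, L < K → x ∈ K := by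
  constructor
  · rintro ⟨-, h⟩
    have hlt : L < sInf {K | L < K} :=
      lt_of_le_of_ne (le_sInf fun K hK => hK.le) fun he => lt_irrefl L (h _ he)
    obtain ⟨x, hx, hxL⟩ := SetLike.exists_of_lt hlt
    exact ⟨x, hxL, fun K hK => Submodule.mem_sInf.1 hx K hK⟩
  · rintro ⟨x, hx, h⟩
    refine ⟨fun he => hx (he ▸ Submodule.mem_top), fun S hS => ?_⟩
    by_contra hLS
    apply hx
    rw [hS, Submodule.mem_sInf]
    intro K hK
    refine h K (lt_of_le_of_ne (hS.trans_le (sInf_le hK)) ?_)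
    rintro rfl
    exact hLS hK

theorem exists_completelyIrreducible_of_notMem {N : Submodule R M} {x : M} (hx : x ∉ N) :
    ∃ L, N ≤ L ∧ x ∉ L ∧ CompletelyIrreducible L := by
  obtain ⟨L, hNL, hL⟩ := zorn_le_nonempty₀ {K : Submodule R M | x ∉ K} (fun c hc hchain y hy =>
    ⟨sSup c, by
      rw [Set.mem_ofPred_eq, Submodule.mem_sSup_of_directed ⟨y, hy⟩ hchain.directedOn]
      rintro ⟨K, hK, hxK⟩
      exact hc hK hxK, fun z hz => le_sSup hz⟩) N hx
  refine ⟨L, hNL, hL.prop, completelyIrreducible_iff.2 ⟨x, hL.prop, fun K hK => ?_⟩⟩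
  by_contra hxK
  exact hK.not_ge (hL.le_of_ge hxK hK.le)

theorem CompletelyIrreducible.comap {K : Submodule R M'} (hK : CompletelyIrreducible K)
    (f : M →ₗ[R] M') (hf : ¬ f.range ≤ K) : CompletelyIrreducible (K.comap f) := by
  obtain ⟨x, hx, h⟩ := completelyIrreducible_iff.1 hK
  obtain ⟨k, hk, y', ⟨y, rfl⟩, rfl⟩ := Submodule.mem_sup.1 (h (K ⊔ f.range) (left_lt_sup.2 hf))
  have hy : f y ∉ K := fun hy => hx (K.add_mem hk hy)
  refine completelyIrreducible_iff.2 ⟨y, hy, fun L hL => ?_⟩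
  have hmap : ¬ L.map f ≤ K := fun hle => hL.not_ge (Submodule.map_le_iff_le_comap.1 hle)
  obtain ⟨k', hk', z', ⟨l, hl, rfl⟩, he⟩ :=
    Submodule.mem_sup.1 (h (K ⊔ L.map f) (left_lt_sup.2 hmap))
  have hmem : y - l ∈ K.comap f := by
    have : f (y - l) = k' - k := by
      rw [map_sub, sub_eq_sub_iff_add_eq_add, add_comm, he]
    rw [Submodule.mem_comap, this]
    exact K.sub_mem hk' hk
  simpa using L.add_mem (hL.le hmem) hl

theorem Submodule.exists_finset_completelyIrreducible_inf_eq [IsArtinian R M] (N : Submodule R M) :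
    ∃ F : Finset (Submodule R M), (∀ L ∈ F, CompletelyIrreducible L) ∧ F.inf id = N := by
  classical
  obtain ⟨_, ⟨F, hF, hNF, rfl⟩, hmin⟩ := IsArtinian.set_has_minimal
    {K : Submodule R M | ∃ F : Finset (Submodule R M),
      (∀ L ∈ F, CompletelyIrreducible L) ∧ N ≤ F.inf id ∧ F.inf id = K}
    ⟨⊤, ∅, by simp, by simp, by simp⟩
  refine ⟨F, hF, le_antisymm (fun x hx => ?_) hNF⟩
  by_contra hxN
  obtain ⟨L, hNL, hxL, hL⟩ := exists_completelyIrreducible_of_notMem hxN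
  have hi : (insert L F).inf id = L ⊓ F.inf id := Finset.inf_insert
  refine hmin _ ⟨insert L F, ?_, hi ▸ le_inf hNL hNF, rfl⟩ ?_
  · simpa [hL] using hF
  · rw [hi]
    exact lt_of_le_of_ne inf_le_right fun he => hxL (inf_eq_right.1 he hx)

theorem Comorphic.quotient (hM : Comorphic R M) (L : Submodule R M) : Comorphic R (M ⧸ L) := by
  intro K hK
  have hsurj : Function.Surjective L.mkQ := L.mkQ_surjective
  obtain ⟨a, ha, hcol⟩ := hM (K.comap L.mkQ) (hK.comap L.mkQ (by
    rw [LinearMap.range_eq_top.2 hsurj, top_le_iff]; exact hK.1))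
  have hmem : ∀ {r : R}, r ∈ K.colon ⊤ ↔ r ∈ (K.comap L.mkQ).colon ⊤ := by
    intro r
    simp only [Submodule.mem_colon, Submodule.mem_comap, map_smul]
    exact ⟨fun h s _ => h _ trivial, fun h s _ => by
      obtain ⟨s, rfl⟩ := hsurj s
      exact h s trivial⟩
  have haK : a ∈ K.colon ⊤ := by
    rw [hmem, hcol]
    exact Ideal.mem_sup_left (Ideal.mem_span_singleton_self a)
  refine ⟨a, le_antisymm ?_ ?_, le_antisymm ?_ ?_⟩
  · intro y hy
    obtain ⟨y, rfl⟩ := hsurj y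
    have hy' : y ∈ K.comap L.mkQ := hy
    rw [ha] at hy'
    obtain ⟨z, -, rfl⟩ := (Submodule.mem_smul_pointwise_iff_exists _ _ _).1 hy'
    exact (Submodule.mem_smul_pointwise_iff_exists _ _ _).2 ⟨L.mkQ z, trivial, rfl⟩
  · intro y hy
    obtain ⟨z, -, rfl⟩ := (Submodule.mem_smul_pointwise_iff_exists _ _ _).1 hy
    exact Submodule.mem_colon.1 haK z trivial
  · intro r hr
    rw [hmem, hcol] at hr
    have hann : (⊤ : Submodule R M).annihilator ≤ (⊤ : Submodule R (M ⧸ L)).annihilator := by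
      intro s hs
      rw [Submodule.mem_annihilator] at hs ⊢
      intro y _
      obtain ⟨y, rfl⟩ := hsurj y
      rw [← map_smul, hs y trivial, map_zero]
    exact sup_le_sup_left hann _ hr
  · refine sup_le ((Ideal.span_singleton_le_iff_mem _).2 haK) fun s hs => ?_
    rw [Submodule.mem_colon]
    intro y _
    rw [Submodule.mem_annihilator.1 hs y trivial]
    exact K.zero_mem

/-- In a cocyclic Artinian comorphic module, the scalars annihilating the socle are nilpotent. -/
theorem Comorphic.exists_pow_smul_eq_zero [IsArtinian R M] (hM : Comorphic R M) {x : M}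
    (hx0 : x ≠ 0) (hx : ∀ K : Submodule R M, K ≠ ⊥ → x ∈ K) {s : R} (hs : s • x = 0) :
    ∃ n, ∀ y : M, s ^ n • y = 0 := by
  have hker : ∀ r : R, (∃ y : M, r • y ≠ 0) →
      ∃ a : R, ∀ y : M, r • y = 0 ↔ ∃ z, a • z = y := by
    rintro r ⟨y, hy⟩
    have hbot : CompletelyIrreducible (⊥ : Submodule R M) :=
      completelyIrreducible_iff.2 ⟨x, by simpa using hx0, fun K hK => hx K hK.ne'⟩
    obtain ⟨a, ha, -⟩ := hM _ (hbot.comap (LinearMap.lsmul R M r) fun hle => hy (by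
      simpa using hle ⟨y, rfl⟩))
    refine ⟨a, fun z => ?_⟩
    have := SetLike.ext_iff.1 ha z
    rw [Submodule.mem_smul_pointwise_iff_exists] at this
    simpa using this
  obtain ⟨n, hn⟩ := IsArtinian.monotone_stabilizes
    (⟨fun n => (LinearMap.lsmul R M (s ^ n)).range, fun i j hij => by
      rintro _ ⟨y, rfl⟩
      refine ⟨s ^ (j - i) • y, ?_⟩
      simp [smul_smul, ← pow_add, Nat.sub_add_cancel hij]⟩ : ℕ →o (Submodule R M)ᵒᵈ)
  by_contra! hne
  obtain ⟨t, ht⟩ := hker (s ^ (n + 1)) (hne _)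
  have hst : ∀ y : M, s ^ (n + 1) • t • y = 0 := fun y => (ht _).2 ⟨y, rfl⟩
  have hsx : s ^ (n + 1) • x = 0 := by rw [pow_succ, mul_smul, hs, smul_zero]
  have hrange : ∀ i j, n ≤ i → n ≤ j → ∀ y : M, ∃ z : M, s ^ j • z = s ^ i • y := by
    intro i j hi hj y
    have h1 : (LinearMap.lsmul R M (s ^ i)).range = (LinearMap.lsmul R M (s ^ j)).range :=
      (hn i hi).symm.trans (hn j hj)
    have h2 : s ^ i • y ∈ (LinearMap.lsmul R M (s ^ i)).range := ⟨y, rfl⟩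
    exact (SetLike.ext_iff.1 h1 _).1 h2
  have hdec : ∀ y : M, ∃ u v : M, y = s ^ (n + 1) • u + t • v := by
    intro y
    obtain ⟨z, hz⟩ := hrange (n + 1) (n + 1 + (n + 1)) (by lia) (by lia) y
    rw [pow_add, mul_smul] at hz
    obtain ⟨v, hv⟩ := (ht (y - s ^ (n + 1) • z)).1 (by rw [smul_sub, hz, sub_self])
    exact ⟨z, v, by rw [hv]; abel⟩
  have htx : t • x = 0 := by
    by_contra htx
    have hinj : ∀ y : M, t • y = 0 → y = 0 := by
      intro y hy
      by_contra hy0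
      have := hx (LinearMap.lsmul R M t).ker fun hb => hy0 (by
        have : y ∈ (LinearMap.lsmul R M t).ker := hy
        simpa [hb] using this)
      exact htx this
    obtain ⟨y, hy⟩ := hne (n + 1)
    exact hy (hinj _ (by rw [smul_comm, hst]))
  have hsurj : ∀ y : M, ∃ z : M, (s ^ (n + 1) + t) • z = y := by
    intro y
    obtain ⟨u, v, rfl⟩ := hdec y
    obtain ⟨u₁, u₂, rfl⟩ := hdec u
    obtain ⟨v₁, v₂, rfl⟩ := hdec v
    refine ⟨s ^ (n + 1) • u₁ + t • v₂, ?_⟩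
    simp only [add_smul, smul_add, hst, smul_comm t (s ^ (n + 1))]
  obtain ⟨a, ha⟩ := hker (s ^ (n + 1) + t) (by
    obtain ⟨z, hz⟩ := hsurj x
    exact ⟨z, hz ▸ hx0⟩)
  obtain ⟨z, hz⟩ := (ha x).1 (by rw [add_smul, hsx, htx, add_zero])
  obtain ⟨w, rfl⟩ := hsurj z
  exact hx0 (by rw [← hz, smul_comm, (ha _).2 ⟨w, rfl⟩])

theorem Ideal.exists_fg_le_forall_smul_eq_bot [IsArtinian R M] (m : Ideal R) :
    ∃ I ≤ m, I.FG ∧ ∀ N : Submodule R M, I • N = ⊥ → m • N = ⊥ := by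
  have hmem : ∀ {J : Ideal R} {y : M},
      y ∈ Submodule.torsionBySet R M (J : Set R) ↔ ∀ r ∈ J, r • y = 0 := by
    intro J y
    simp [Submodule.mem_torsionBySet_iff]
  obtain ⟨_, ⟨I, hIm, hI, rfl⟩, hmin⟩ := IsArtinian.set_has_minimal
    {T : Submodule R M | ∃ I ≤ m, I.FG ∧ Submodule.torsionBySet R M (I : Set R) = T}
    ⟨_, ⊥, bot_le, Submodule.fg_bot, rfl⟩
  refine ⟨I, hIm, hI, fun N hN => ?_⟩
  rw [eq_bot_iff, Submodule.smul_le]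
  intro s hs y hy
  have hyI : y ∈ Submodule.torsionBySet R M (I : Set R) := hmem.2 fun r hr => by
    simpa [hN] using Submodule.smul_mem_smul hr hy
  have hle : Submodule.torsionBySet R M ((I ⊔ Ideal.span {s} : Ideal R) : Set R) ≤
      Submodule.torsionBySet R M (I : Set R) := fun z hz =>
    hmem.2 fun r hr => hmem.1 hz r (Ideal.mem_sup_left hr)
  have heq := eq_of_le_of_not_lt hle (hmin _ ⟨I ⊔ Ideal.span {s},
    sup_le hIm ((Ideal.span_singleton_le_iff_mem _).2 hs),
    Submodule.FG.sup hI (Submodule.fg_span_singleton s), rfl⟩)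
  rw [← heq] at hyI
  simpa using hmem.1 hyI s (Ideal.mem_sup_right (Ideal.mem_span_singleton_self s))

theorem Comorphic.exists_isMaximal_pow_le_colon [IsArtinian R M] (hM : Comorphic R M)
    {L : Submodule R M} (hL : CompletelyIrreducible L) :
    ∃ m : Ideal R, m.IsMaximal ∧ ∃ k, m ^ k ≤ L.colon ⊤ := by
  obtain ⟨x, hxL, hx⟩ := completelyIrreducible_iff.1 hL
  have hx0 : L.mkQ x ≠ 0 := by simpa using hxL
  have hsoc : ∀ K : Submodule R (M ⧸ L), K ≠ ⊥ → L.mkQ x ∈ K := by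
    intro K hK
    refine hx (K.comap L.mkQ) (lt_of_le_of_ne (L.le_comap_mkQ K) fun he => hK ?_)
    have := Submodule.map_comap_eq_of_surjective L.mkQ_surjective K
    rw [← he, Submodule.mkQ_map_self] at this
    exact this.symm
  set m : Ideal R := L.colon {x}
  have hmem : ∀ {r : R}, r ∈ m ↔ r • x ∈ L := Submodule.mem_colon_singleton
  have hmax : m.IsMaximal := by
    refine Ideal.isMaximal_iff.2 ⟨fun h => hxL (by simpa using hmem.1 h), fun J s hJ hs hsJ => ?_⟩
    have := hx (L ⊔ R ∙ (s • x)) (left_lt_sup.2 fun hle => hs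
      (hmem.2 (hle (Submodule.mem_span_singleton_self _))))
    obtain ⟨l, hl, z, hz, he⟩ := Submodule.mem_sup.1 this
    obtain ⟨c, rfl⟩ := Submodule.mem_span_singleton.1 hz
    have h1 : 1 - c * s ∈ m := hmem.2 (by
      have : (1 - c * s) • x = l := by
        rw [sub_smul, one_smul, mul_smul, sub_eq_iff_eq_add, he]
      rwa [this])
    simpa using J.add_mem (hJ h1) (J.mul_mem_left c hsJ)
  have hcol : ∀ {r : R}, r ∈ L.colon ⊤ ↔ ∀ y : M ⧸ L, r • y = 0 := by
    intro r
    rw [Submodule.mem_colon]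
    refine ⟨fun h y => ?_, fun h y _ => ?_⟩
    · obtain ⟨y, rfl⟩ := L.mkQ_surjective y
      rw [← map_smul, Submodule.mkQ_apply, Submodule.Quotient.mk_eq_zero]
      exact h y trivial
    · rw [← Submodule.Quotient.mk_eq_zero, Submodule.Quotient.mk_smul]
      exact h _
  obtain ⟨I, hIm, hI, hImN⟩ := m.exists_fg_le_forall_smul_eq_bot (M := M ⧸ L)
  have hrad : I ≤ (L.colon ⊤).radical := by
    intro s hs
    obtain ⟨n, hn⟩ := (hM.quotient L).exists_pow_smul_eq_zero hx0 hsoc (s := s) (by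
      rw [← map_smul, Submodule.mkQ_apply, Submodule.Quotient.mk_eq_zero]
      exact hmem.1 (hIm hs))
    exact ⟨n, hcol.2 hn⟩
  obtain ⟨k, hk⟩ := Ideal.exists_pow_le_of_le_radical_of_fg hrad hI
  have hpow : ∀ (k : ℕ) (N : Submodule R (M ⧸ L)), I ^ k • N = ⊥ → m ^ k • N = ⊥ := by
    intro k
    induction k with
    | zero => simp
    | succ k ih =>
      intro N hN
      rw [pow_succ, mul_smul] at hN
      have h := ih _ hN
      rw [← mul_smul, mul_comm, mul_smul] at h
      rw [pow_succ', mul_smul]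
      exact hImN _ h
  refine ⟨m, hmax, k, fun r hr => hcol.2 fun y => ?_⟩
  have hbot : I ^ k • (⊤ : Submodule R (M ⧸ L)) = ⊥ := by
    rw [eq_bot_iff, Submodule.smul_le]
    intro r hr y _
    exact hcol.1 (hk hr) y
  have := Submodule.smul_mem_smul hr (Submodule.mem_top (x := y))
  rwa [hpow k _ hbot] at this

theorem Submodule.eq_top_of_sup_smul_top_eq_top {m : Ideal R} {k : ℕ}
    (hk : m ^ k • (⊤ : Submodule R M) = ⊥) {N : Submodule R M} (hN : N ⊔ m • ⊤ = ⊤) : N = ⊤ := by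
  have h : ∀ j : ℕ, N ⊔ m ^ j • ⊤ = ⊤ := by
    intro j
    induction j with
    | zero => simp
    | succ j ih =>
      refine eq_top_iff.2 (ih.ge.trans (sup_le le_sup_left ?_))
      rw [pow_succ, mul_smul]
      have hle : m ^ j • (N ⊔ m • ⊤) ≤ N ⊔ m ^ j • m • ⊤ := by
        rw [Submodule.smul_sup]
        exact sup_le (le_sup_of_le_left Submodule.smul_le_right) le_sup_right
      rwa [hN] at hle
  simpa [hk] using h k

theorem Comorphic.exists_eq_pow_smul_top (hM : Comorphic R M) {m : Ideal R} [hm : m.IsMaximal]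
    {k : ℕ} (hk : m ^ k • (⊤ : Submodule R M) = ⊥) :
    ∃ a : R, ∀ N : Submodule R M, ∃ j : ℕ, N = a ^ j • ⊤ := by
  by_cases htop : m • (⊤ : Submodule R M) = ⊤
  · have : (⊥ : Submodule R M) = ⊤ :=
      Submodule.eq_top_of_sup_smul_top_eq_top hk (by rw [htop, sup_top_eq])
    have := (Submodule.subsingleton_iff R (M := M)).1 (subsingleton_of_bot_eq_top this)
    exact ⟨0, fun N => ⟨0, Subsingleton.elim _ _⟩⟩
  obtain ⟨x₀, -, hx₀⟩ := SetLike.exists_of_lt (lt_top_iff_ne_top.2 htop)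
  obtain ⟨K, hmK, -, hK⟩ := exists_completelyIrreducible_of_notMem hx₀
  obtain ⟨x, hxK, hx⟩ := completelyIrreducible_iff.1 hK
  obtain ⟨a, ha, hcol⟩ := hM K hK
  have hmcol : K.colon ⊤ = m := by
    refine (hm.eq_of_le (fun h => hxK ?_) fun r hr => ?_).symm
    · simpa using Submodule.mem_colon.1 ((Ideal.eq_top_iff_one _).1 h) x trivial
    · exact Submodule.mem_colon.2 fun y _ => hmK (Submodule.smul_mem_smul hr trivial)
  have ham : a ∈ m := by
    rw [← hmcol, hcol]
    exact Ideal.mem_sup_left (Ideal.mem_span_singleton_self a)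
  have hKm : K ≤ m • ⊤ := by
    rw [ha]
    intro y hy
    obtain ⟨z, -, rfl⟩ := (Submodule.mem_smul_pointwise_iff_exists _ _ _).1 hy
    exact Submodule.smul_mem_smul ham trivial
  have hspan : ∀ u ∉ K, R ∙ u = ⊤ := by
    intro u hu
    refine Submodule.eq_top_of_sup_smul_top_eq_top hk (eq_top_iff.2 ?_)
    refine le_trans (fun y _ => ?_) (sup_le_sup_left hKm _)
    have hxu : ∀ {v : M}, v ∉ K → x ∈ (R ∙ v) ⊔ K := fun {v} hv =>
      hx _ (right_lt_sup.2 fun hle => hv (hle (Submodule.mem_span_singleton_self v)))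
    by_cases hy : y ∈ K
    · exact Submodule.mem_sup_right hy
    obtain ⟨z, hz, l, hl, he⟩ := Submodule.mem_sup.1 (hxu hy)
    obtain ⟨r, rfl⟩ := Submodule.mem_span_singleton.1 hz
    have hr : r ∉ m := fun hr => hxK (by
      rw [← he]
      exact K.add_mem (hmK (Submodule.smul_mem_smul hr trivial)) hl)
    obtain ⟨c, i, hi, hc⟩ := hm.exists_inv hr
    have hy' : y = c • x - c • l + i • y := by
      rw [← he, smul_add, add_sub_cancel_right, smul_smul, ← add_smul, hc, one_smul]
    rw [hy']
    exact add_mem (sub_mem (Submodule.smul_mem _ _ (hxu hu))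
      (Submodule.smul_mem _ _ (Submodule.mem_sup_right hl)))
      (Submodule.mem_sup_right (hmK (Submodule.smul_mem_smul hi trivial)))
  have hak : a ^ k • (⊤ : Submodule R M) = ⊥ := by
    rw [eq_bot_iff, ← hk]
    intro y hy
    obtain ⟨z, -, rfl⟩ := (Submodule.mem_smul_pointwise_iff_exists _ _ _).1 hy
    exact Submodule.smul_mem_smul (Ideal.pow_mem_pow ham k) trivial
  refine ⟨a, fun N => ?_⟩
  by_cases hN : N = ⊥
  · exact ⟨k, hN.trans hak.symm⟩
  classical
  have hex : ∃ j : ℕ, ¬ N ≤ a ^ j • ⊤ := ⟨k, by rwa [hak, le_bot_iff]⟩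
  obtain ⟨j, hj⟩ : ∃ j, Nat.find hex = j + 1 := Nat.exists_eq_succ_of_ne_zero fun h0 =>
    Nat.find_spec hex (by rw [h0]; simp)
  have hle : N ≤ a ^ j • ⊤ := not_not.1 (Nat.find_min hex (m := j) (by lia))
  refine ⟨j, le_antisymm hle ?_⟩
  have hnot := Nat.find_spec hex
  rw [hj] at hnot
  obtain ⟨y, hyN, hy⟩ := SetLike.not_le_iff_exists.1 hnot
  obtain ⟨u, -, rfl⟩ := (Submodule.mem_smul_pointwise_iff_exists _ _ _).1 (hle hyN)
  have hu : u ∉ K := by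
    rw [ha]
    intro hu
    obtain ⟨v, -, rfl⟩ := (Submodule.mem_smul_pointwise_iff_exists _ _ _).1 hu
    exact hy ((Submodule.mem_smul_pointwise_iff_exists _ _ _).2
      ⟨v, trivial, by rw [pow_succ, mul_smul]⟩)
  intro z hz
  obtain ⟨w, -, rfl⟩ := (Submodule.mem_smul_pointwise_iff_exists _ _ _).1 hz
  obtain ⟨c, rfl⟩ := Submodule.mem_span_singleton.1 (hspan u hu ▸ Submodule.mem_top (x := w))
  rw [smul_comm]
  exact N.smul_mem c hyN

theorem Comorphic.le_total_or_isCoprime_colon [IsArtinian R M] (hM : Comorphic R M)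
    {L L' : Submodule R M} (hL : CompletelyIrreducible L) (hL' : CompletelyIrreducible L') :
    (L ≤ L' ∨ L' ≤ L) ∨ IsCoprime (L.colon ⊤) (L'.colon ⊤) := by
  obtain ⟨m, hm, k, hk⟩ := hM.exists_isMaximal_pow_le_colon hL
  obtain ⟨m', hm', k', hk'⟩ := hM.exists_isMaximal_pow_le_colon hL'
  by_cases hmm : m = m'
  · subst hmm
    left
    have hbot : m ^ max k k' • (⊤ : Submodule R (M ⧸ (L ⊓ L'))) = ⊥ := by
      rw [eq_bot_iff, Submodule.smul_le]
      intro r hr y _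
      obtain ⟨y, rfl⟩ := Submodule.mkQ_surjective _ y
      rw [← map_smul, Submodule.mem_bot, Submodule.mkQ_apply, Submodule.Quotient.mk_eq_zero]
      exact ⟨Submodule.mem_colon.1 (hk (Ideal.pow_le_pow_right (le_max_left _ _) hr)) y trivial,
        Submodule.mem_colon.1 (hk' (Ideal.pow_le_pow_right (le_max_right _ _) hr)) y trivial⟩
    obtain ⟨a, ha⟩ := (hM.quotient (L ⊓ L')).exists_eq_pow_smul_top hbot
    obtain ⟨i, hi⟩ := ha (L.map (L ⊓ L').mkQ)
    obtain ⟨j, hj⟩ := ha (L'.map (L ⊓ L').mkQ)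
    have hanti : ∀ {i j : ℕ}, i ≤ j →
        a ^ j • (⊤ : Submodule R (M ⧸ (L ⊓ L'))) ≤ a ^ i • ⊤ := by
      intro i j hij y hy
      obtain ⟨z, -, rfl⟩ := (Submodule.mem_smul_pointwise_iff_exists _ _ _).1 hy
      exact (Submodule.mem_smul_pointwise_iff_exists _ _ _).2
        ⟨a ^ (j - i) • z, trivial, by rw [smul_smul, ← pow_add, Nat.add_sub_cancel' hij]⟩
    have hle : ∀ {P Q : Submodule R M}, L ⊓ L' ≤ Q →
        P.map (L ⊓ L').mkQ ≤ Q.map (L ⊓ L').mkQ → P ≤ Q := by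
      intro P Q hQ h
      rwa [Submodule.map_le_iff_le_comap, Submodule.comap_map_mkQ, sup_eq_right.2 hQ] at h
    rcases le_total i j with h | h
    · exact Or.inr (hle inf_le_left (hj ▸ hi ▸ hanti h))
    · exact Or.inl (hle inf_le_right (hj ▸ hi ▸ hanti h))
  · right
    rw [Ideal.isCoprime_iff_sup_eq, eq_top_iff,
      ← ((Ideal.isCoprime_of_isMaximal hmm).pow (m := k) (n := k')).sup_eq]
    exact sup_le_sup hk hk'

theorem Ideal.smul_top_inf_smul_top_of_isCoprime {I J : Ideal R} (h : IsCoprime I J) :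
    I • (⊤ : Submodule R M) ⊓ J • ⊤ = (I * J) • ⊤ := by
  apply le_antisymm
  · rintro x ⟨hxI, hxJ⟩
    obtain ⟨e, he, f, hf, hef⟩ := Ideal.isCoprime_iff_exists.1 h
    rw [← one_smul R x, ← hef, add_smul]
    refine add_mem ?_ ?_
    · rw [mul_smul]
      exact Submodule.smul_mem_smul he hxJ
    · rw [mul_comm, mul_smul]
      exact Submodule.smul_mem_smul hf hxI
  · exact le_inf (Submodule.smul_mono_left Ideal.mul_le_left)
      (Submodule.smul_mono_left Ideal.mul_le_right)

theorem Comorphic.colon_smul_top (hM : Comorphic R M) {L : Submodule R M}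
    (hL : CompletelyIrreducible L) :
    L.colon ⊤ • (⊤ : Submodule R M) = L ∧ ∃ a : R, L = a • (⊤ : Submodule R M) := by
  obtain ⟨a, ha, hcol⟩ := hM L hL
  refine ⟨le_antisymm (Submodule.smul_le.2 fun r hr y _ => Submodule.mem_colon.1 hr y trivial)
    fun y hy => ?_, a, ha⟩
  have haL : a ∈ L.colon ⊤ := by
    rw [hcol]
    exact Ideal.mem_sup_left (Ideal.mem_span_singleton_self a)
  rw [ha] at hy
  obtain ⟨z, -, rfl⟩ := (Submodule.mem_smul_pointwise_iff_exists _ _ _).1 hy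
  exact Submodule.smul_mem_smul haL trivial

theorem Comorphic.finset_inf_eq_prod_colon_smul_top (hM : Comorphic R M)
    (F : Finset (Submodule R M)) (hF : ∀ L ∈ F, CompletelyIrreducible L)
    (hcop : (F : Set (Submodule R M)).Pairwise
      fun L L' => IsCoprime (L.colon ⊤) (L'.colon ⊤)) :
    F.inf id = (∏ L ∈ F, L.colon ⊤ : Ideal R) • (⊤ : Submodule R M) ∧
      ∃ r : R, F.inf id = r • (⊤ : Submodule R M) := by
  classical
  induction F using Finset.induction_on with
  | empty => exact ⟨by simp, 1, by simp⟩
  | insert L F hLF ih =>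
    obtain ⟨h1, r, hr⟩ := ih (fun K hK => hF K (Finset.mem_insert_of_mem hK))
      (hcop.mono (by simp))
    obtain ⟨h2, a, ha⟩ := hM.colon_smul_top (hF L (Finset.mem_insert_self _ _))
    have hLcop : IsCoprime (L.colon ⊤ : Ideal R) (∏ K ∈ F, K.colon ⊤) :=
      IsCoprime.prod_right fun K hK => hcop (by simp) (by simp [hK])
        (by rintro rfl; exact hLF hK)
    have h3 : (insert L F).inf id = (∏ K ∈ insert L F, K.colon ⊤ : Ideal R) • ⊤ := by
      rw [Finset.inf_insert, Finset.prod_insert hLF, h1, id,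
        ← Ideal.smul_top_inf_smul_top_of_isCoprime hLcop, h2]
    refine ⟨h3, r * a, ?_⟩
    rw [h3, Finset.prod_insert hLF, mul_smul, ← h1, hr, ← Submodule.ideal_span_singleton_smul,
      ← mul_smul, mul_comm, mul_smul, h2, Submodule.ideal_span_singleton_smul, mul_smul, ← ha]

end Helpers

theorem artinian_comorphic_is_principal_ideal_multiplication {R M : Type*} [CommRing R] [AddCommGroup M] [Module R M]
    [IsArtinian R M] (hM : Comorphic R M) :
    ∀ N : Submodule R M, ∃ r : R, N = r • (⊤ : Submodule R M) := by
  classical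
  intro N
  obtain ⟨F, ⟨hF, rfl⟩, hmin⟩ := exists_minimalFor_of_wellFoundedLT
    (fun F : Finset (Submodule R M) =>
      (∀ L ∈ F, CompletelyIrreducible L) ∧ F.inf id = N) Finset.card
    N.exists_finset_completelyIrreducible_inf_eq
  refine (hM.finset_inf_eq_prod_colon_smul_top F hF ?_).2
  have hanti : ∀ L ∈ F, ∀ L' ∈ F, L ≠ L' → ¬ L ≤ L' := by
    intro L hL L' hL' hne hle
    have hcard := hmin (j := F.erase L')
      ⟨fun K hK => hF K (Finset.mem_of_mem_erase hK), ?_⟩ (Finset.card_erase_le)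
    · exact hcard.not_gt (Finset.card_erase_lt_of_mem hL')
    · conv_rhs => rw [← Finset.insert_erase hL', Finset.inf_insert]
      exact (inf_eq_right.2 ((Finset.inf_le (Finset.mem_erase.2 ⟨hne, hL⟩)).trans hle)).symm
  intro L hL L' hL' hne
  exact (hM.le_total_or_isCoprime_colon (hF L hL) (hF L' hL')).resolve_left fun h =>
    h.elim (hanti L hL L' hL' hne) (hanti L' hL' L hL hne.symm)
end

section
/- Let R be a commutative ring with identity and M a comorphic R-module which satisfies the double annihilator condition (DAC) and for which I^M_0(M) ≠ 0. Then R is a morphic ring, i.e., for every a ∈ R there exists b ∈ R such that Ra = Ann_R(Rb) and Ann_R(Ra) = Rb. -/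
open Pointwise

/-- `M` satisfies the double annihilator condition: `I = Ann_R((0 :_M I))` for every ideal `I`. -/
def SatisfiesDAC (R M : Type*) [CommRing R] [AddCommGroup M] [Module R M] : Prop :=
  ∀ I : Ideal R, I = (Submodule.torsionBySet R M (I : Set R)).annihilator

/-- `I^M_0(M)`: the intersection of all completely irreducible submodules `L` of `M`
such that `rM ⊆ L` for some nonzero `r ∈ R`. -/
def I0 (R M : Type*) [CommRing R] [AddCommGroup M] [Module R M] : Submodule R M :=
  sInf {L : Submodule R M | CompletelyIrreducible L ∧
    ∃ r : R, r ≠ 0 ∧ r • (⊤ : Submodule R M) ≤ L}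

/-- Every nonzero element is avoided by some completely irreducible submodule. -/
theorem exists_completelyIrreducible_notMem {R M : Type*} [CommRing R] [AddCommGroup M]
    [Module R M] {x : M} (hx : x ≠ 0) :
    ∃ L : Submodule R M, CompletelyIrreducible L ∧ x ∉ L := by
  obtain ⟨L, -, hL⟩ := zorn_le_nonempty₀ {N : Submodule R M | x ∉ N} (fun c hc hchain y hy => by
    refine ⟨sSup c, fun hmem => ?_, fun N hN => le_sSup hN⟩
    obtain ⟨N, hN, hxN⟩ := (Submodule.mem_sSup_of_directed ⟨y, hy⟩ hchain.directedOn).1 hmem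
    exact hc hN hxN) ⊥ (by simpa using hx)
  have hxL : x ∉ L := hL.prop
  refine ⟨L, ⟨fun h => hxL (h ▸ Submodule.mem_top), fun S hS => ?_⟩, hxL⟩
  by_contra hLS
  refine hxL (hS ▸ Submodule.mem_sInf.2 fun N hN => ?_)
  by_contra hxN
  have hle : L ≤ N := hS.le.trans (sInf_le hN)
  exact hLS (le_antisymm hle (hL.le_of_ge hxN hle) ▸ hN)

/-- If the zero submodule is completely irreducible, some nonzero element lies in every nonzero
submodule. -/
theorem CompletelyIrreducible.exists_mem_of_ne_bot {R M : Type*} [CommRing R] [AddCommGroup M]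
    [Module R M] (h : CompletelyIrreducible (⊥ : Submodule R M)) :
    ∃ y : M, y ≠ 0 ∧ ∀ N : Submodule R M, N ≠ ⊥ → y ∈ N := by
  have hne : sInf {N : Submodule R M | N ≠ ⊥} ≠ ⊥ := fun h' => h.2 _ h'.symm rfl
  obtain ⟨y, hy, hy0⟩ := Submodule.exists_mem_ne_zero_of_ne_bot hne
  exact ⟨y, hy0, fun N hN => Submodule.mem_sInf.1 hy N hN⟩

/-- If the zero submodule is completely irreducible, so is the kernel of multiplication by any
element that does not annihilate the module. -/
theorem CompletelyIrreducible.torsionBy {R M : Type*} [CommRing R] [AddCommGroup M]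
    [Module R M] (h : CompletelyIrreducible (⊥ : Submodule R M)) {a : R}
    (ha : Submodule.torsionBy R M a ≠ ⊤) :
    CompletelyIrreducible (Submodule.torsionBy R M a) := by
  refine ⟨ha, fun S hS => ?_⟩
  obtain ⟨y, hy0, hy⟩ := h.exists_mem_of_ne_bot
  by_contra hmem
  have hlift : ∀ N ∈ S, ∃ n ∈ N, a • n = y := fun N hN => by
    have hne : a • N ≠ ⊥ := fun hbot => by
      have hle : N ≤ Submodule.torsionBy R M a := fun n hn => by
        have := Submodule.smul_mem_pointwise_smul n a N hn
        rw [hbot, Submodule.mem_bot] at this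
        exact (Submodule.mem_torsionBy_iff a n).2 this
      exact hmem (le_antisymm (hS.le.trans (sInf_le hN)) hle ▸ hN)
    obtain ⟨n, hn, hny⟩ := (Submodule.mem_smul_pointwise_iff_exists y a N).1 (hy _ hne)
    exact ⟨n, hn, hny⟩
  obtain rfl | ⟨N₀, hN₀⟩ := S.eq_empty_or_nonempty
  · exact ha (hS.trans sInf_empty)
  obtain ⟨n₀, -, hn₀⟩ := hlift N₀ hN₀
  have hn₀S : n₀ ∈ Submodule.torsionBy R M a := by
    rw [hS, Submodule.mem_sInf]
    intro N hN
    obtain ⟨n, hn, hny⟩ := hlift N hN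
    have hsub : n₀ - n ∈ Submodule.torsionBy R M a :=
      (Submodule.mem_torsionBy_iff a _).2 (by rw [smul_sub, hn₀, hny, sub_self])
    have := N.add_mem ((hS.le.trans (sInf_le hN)) hsub) hn
    rwa [sub_add_cancel] at this
  exact hy0 (hn₀ ▸ (Submodule.mem_torsionBy_iff a n₀).1 hn₀S)

theorem SatisfiesDAC.eq_zero_of_forall_smul_eq_zero {R M : Type*} [CommRing R] [AddCommGroup M]
    [Module R M] (h : SatisfiesDAC R M) {r : R} (hr : ∀ m : M, r • m = 0) : r = 0 := by
  have hmem : r ∈ (⊥ : Ideal R) := by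
    rw [h ⊥, Submodule.mem_annihilator]
    exact fun m _ => hr m
  simpa using hmem

theorem SatisfiesDAC.mem_span_singleton_iff {R M : Type*} [CommRing R] [AddCommGroup M]
    [Module R M] (h : SatisfiesDAC R M) (a r : R) :
    r ∈ Ideal.span {a} ↔ ∀ m ∈ Submodule.torsionBy R M a, r • m = 0 := by
  rw [h (Ideal.span {a}), Submodule.torsionBySet_span_singleton_eq, Submodule.mem_annihilator]

/-- For a comorphic module with `I0 R M ≠ ⊥`, the zero submodule is completely irreducible. -/
theorem Comorphic.completelyIrreducible_bot {R M : Type*} [CommRing R] [AddCommGroup M]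
    [Module R M] (hM : Comorphic R M) (hI0 : I0 R M ≠ ⊥) :
    CompletelyIrreducible (⊥ : Submodule R M) := by
  obtain ⟨x, hx, hx0⟩ := Submodule.exists_mem_ne_zero_of_ne_bot hI0
  obtain ⟨L, hL, hxL⟩ := exists_completelyIrreducible_notMem (R := R) hx0
  obtain ⟨b, hb, -⟩ := hM L hL
  by_cases hb0 : b = 0
  · have hbot : L = ⊥ := by rw [hb, hb0, zero_smul]; rfl
    exact hbot ▸ hL
  · exact absurd (Submodule.mem_sInf.1 hx L ⟨hL, b, hb0, hb.ge⟩) hxL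

theorem morphic_ring_of_comorphic_DAC {R M : Type*} [CommRing R] [AddCommGroup M] [Module R M]
    (hM : Comorphic R M) (hdac : SatisfiesDAC R M) (hI0 : I0 R M ≠ ⊥) :
    ∀ a : R, ∃ b : R, Ideal.span {a} = (Ideal.span {b}).annihilator ∧
      (Ideal.span {a}).annihilator = Ideal.span {b} := by
  intro a
  have hfaith : (⊤ : Submodule R M).annihilator = ⊥ := by
    refine (Submodule.eq_bot_iff _).2 fun r hr => ?_
    exact hdac.eq_zero_of_forall_smul_eq_zero fun m =>
      Submodule.mem_annihilator.1 hr m Submodule.mem_top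
  by_cases ha : a = 0
  · refine ⟨1, ?_, ?_⟩ <;> ext r <;> rw [Ideal.span, Ideal.span,
      Submodule.mem_annihilator_span_singleton, Submodule.mem_span_singleton] <;> simp [ha, eq_comm]
  have htop : Submodule.torsionBy R M a ≠ ⊤ := fun h =>
    ha (hdac.eq_zero_of_forall_smul_eq_zero fun m =>
      (Submodule.mem_torsionBy_iff a m).1 (h ▸ Submodule.mem_top))
  obtain ⟨b, hb, hcolon⟩ := hM _ ((hM.completelyIrreducible_bot hI0).torsionBy htop)
  rw [hfaith, Submodule.add_eq_sup, sup_bot_eq] at hcolon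
  refine ⟨b, ?_, ?_⟩
  · ext r
    rw [hdac.mem_span_singleton_iff, hb, Ideal.span, Submodule.mem_annihilator_span_singleton,
      smul_eq_mul]
    constructor
    · refine fun h => hdac.eq_zero_of_forall_smul_eq_zero fun m => ?_
      rw [mul_smul]
      exact h _ (Submodule.smul_mem_pointwise_smul m b ⊤ Submodule.mem_top)
    · rintro h m hm
      obtain ⟨n, -, rfl⟩ := (Submodule.mem_smul_pointwise_iff_exists m b ⊤).1 hm
      rw [← mul_smul, h, zero_smul]
  · rw [← hcolon]
    ext r
    rw [Ideal.span, Submodule.mem_annihilator_span_singleton, smul_eq_mul, Submodule.mem_colon]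
    constructor
    · intro h m _
      rw [Submodule.mem_torsionBy_iff, ← mul_smul, mul_comm, h, zero_smul]
    · refine fun h => hdac.eq_zero_of_forall_smul_eq_zero fun m => ?_
      rw [mul_comm, mul_smul]
      exact (Submodule.mem_torsionBy_iff a _).1 (h m trivial)
end
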